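/- Identify $\mathbb{H}^n \cong \mathbb{R}^{4n}$ ($n \geq 2$) with right-multiplication complex structures $I, J, K$. Define $Sp(n)U(1) = \{g \in SO(4n) : gI = Ig \text{ and } g \cdot \mathrm{span}\{J,K\} = \mathrm{span}\{J,K\}\}$ (conjugation action on endomorphisms). For the unit vector $x = e_1 \in \mathbb{H}^n$, the stabilizer $H = \{g \in Sp(n)U(1) : g(x) = x\}$ fixes $Ix$ and acts without nonzero fixed vectors on $\mathrm{span}\{x, Ix\}^{\perp}$; in particular the maximal subspace on which $H$ acts trivially is $\mathrm{span}\{x, Ix\}$. -/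

import Mathlib

open Kronecker

noncomputable def quatI (n : ℕ) : Matrix (Fin n × Fin 4) (Fin n × Fin 4) ℝ :=
  (1 : Matrix (Fin n) (Fin n) ℝ) ⊗ₖ !![0, 1, 0, 0; -1, 0, 0, 0; 0, 0, 0, -1; 0, 0, 1, 0]

noncomputable def quatJ (n : ℕ) : Matrix (Fin n × Fin 4) (Fin n × Fin 4) ℝ :=
  (1 : Matrix (Fin n) (Fin n) ℝ) ⊗ₖ !![0, 0, 1, 0; 0, 0, 0, 1; -1, 0, 0, 0; 0, -1, 0, 0]

noncomputable def quatK (n : ℕ) : Matrix (Fin n × Fin 4) (Fin n × Fin 4) ℝ :=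
  (1 : Matrix (Fin n) (Fin n) ℝ) ⊗ₖ !![0, 0, 0, 1; 0, 0, -1, 0; 0, 1, 0, 0; -1, 0, 0, 0]

/-- Membership in `Sp(n)U(1) = {g ∈ SO(4n) : gI = Ig, g·span{J,K}·g⁻¹ = span{J,K}}`. -/
noncomputable def memSpnU1 (n : ℕ) (g : Matrix (Fin n × Fin 4) (Fin n × Fin 4) ℝ) : Prop :=
  g * g.transpose = 1 ∧ g.det = 1 ∧ g * quatI n = quatI n * g ∧
    ∀ L ∈ Submodule.span ℝ ({quatJ n, quatK n} : Set (Matrix (Fin n × Fin 4) (Fin n × Fin 4) ℝ)),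
      g * L * g⁻¹ ∈ Submodule.span ℝ
        ({quatJ n, quatK n} : Set (Matrix (Fin n × Fin 4) (Fin n × Fin 4) ℝ))

/-- An element of `SO(4n)` that commutes with `I` and commutes up to a common scalar with `J` and
`K` lies in `Sp(n)U(1)`. -/
theorem memSpnU1_of_mul_eq_smul {n : ℕ} {g : Matrix (Fin n × Fin 4) (Fin n × Fin 4) ℝ} (ε : ℝ)
    (hg : g * g.transpose = 1) (hdet : g.det = 1) (hI : g * quatI n = quatI n * g)
    (hJ : g * quatJ n = ε • (quatJ n * g)) (hK : g * quatK n = ε • (quatK n * g)) :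
    memSpnU1 n g := by
  refine ⟨hg, hdet, hI, fun L hL => ?_⟩
  have hcomm : g * L = ε • (L * g) := by
    obtain ⟨a, b, rfl⟩ := Submodule.mem_span_pair.mp hL
    rw [mul_add, mul_smul_comm, mul_smul_comm, hJ, hK, add_mul, smul_mul_assoc, smul_mul_assoc,
      smul_add, smul_comm a, smul_comm b]
  have hunit : IsUnit g.det := by simp [hdet]
  rw [hcomm, smul_mul_assoc, Matrix.mul_nonsing_inv_cancel_right _ _ hunit]
  exact Submodule.smul_mem _ _ hL

/-- Diagonal sign changes of the quaternionic coordinates lie in `Sp(n)U(1)`. -/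
theorem memSpnU1_diagonal_kronecker_one {n : ℕ} {a : Fin n → ℝ} (ha : ∀ i, a i ^ 2 = 1) :
    memSpnU1 n (Matrix.diagonal a ⊗ₖ (1 : Matrix (Fin 4) (Fin 4) ℝ)) := by
  refine memSpnU1_of_mul_eq_smul 1 ?_ ?_ ?_ ?_ ?_
  · rw [← Matrix.kroneckerMap_transpose, ← Matrix.mul_kronecker_mul]
    simp [← sq (a _), ha]
  · rw [Matrix.det_kronecker, Matrix.det_diagonal, Fintype.card_fin, ← Finset.prod_pow]
    have h4 : ∀ i, a i ^ 4 = 1 := fun i => by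
      rw [show 4 = 2 * 2 from rfl, pow_mul, ha, one_pow]
    simp [h4]
  · simp [quatI, ← Matrix.mul_kronecker_mul]
  · simp [quatJ, ← Matrix.mul_kronecker_mul]
  · simp [quatK, ← Matrix.mul_kronecker_mul]

/-- Conjugation by `i` on every quaternionic coordinate lies in `Sp(n)U(1)`. -/
theorem memSpnU1_one_kronecker_diagonal (n : ℕ) :
    memSpnU1 n ((1 : Matrix (Fin n) (Fin n) ℝ) ⊗ₖ Matrix.diagonal ![1, 1, -1, -1]) := by
  refine memSpnU1_of_mul_eq_smul (-1) ?_ ?_ ?_ ?_ ?_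
  · rw [← Matrix.kroneckerMap_transpose, ← Matrix.mul_kronecker_mul, Matrix.diagonal_transpose,
      Matrix.diagonal_mul_diagonal, Matrix.transpose_one, one_mul, ← Matrix.one_kronecker_one]
    congr 1
    ext i j
    fin_cases i <;> fin_cases j <;> simp [Matrix.diagonal]
  · simp [Matrix.det_kronecker, Matrix.det_diagonal, Fin.prod_univ_four]
  · rw [quatI, ← Matrix.mul_kronecker_mul, ← Matrix.mul_kronecker_mul]
    congr 1
    ext i j
    fin_cases i <;> fin_cases j <;> simp [Matrix.diagonal_mul, Matrix.mul_diagonal]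
  · rw [quatJ, ← Matrix.mul_kronecker_mul, ← Matrix.mul_kronecker_mul, ← Matrix.kronecker_smul]
    congr 1
    ext i j
    fin_cases i <;> fin_cases j <;> simp [Matrix.diagonal_mul, Matrix.vecMul_diagonal]
  · rw [quatK, ← Matrix.mul_kronecker_mul, ← Matrix.mul_kronecker_mul, ← Matrix.kronecker_smul]
    congr 1
    ext i j
    fin_cases i <;> fin_cases j <;> simp [Matrix.diagonal_mul, Matrix.vecMul_diagonal]

theorem diagonal_kronecker_diagonal_mulVec {n : ℕ} (a : Fin n → ℝ) (b : Fin 4 → ℝ)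
    (v : Fin n × Fin 4 → ℝ) (p : Fin n × Fin 4) :
    (Matrix.diagonal a ⊗ₖ Matrix.diagonal b).mulVec v p = a p.1 * b p.2 * v p := by
  rw [Matrix.diagonal_kronecker_diagonal, Matrix.mulVec_diagonal]

theorem quatI_mulVec_single {n : ℕ} (i : Fin n) :
    (quatI n).mulVec (Pi.single (i, 0) 1) = -Pi.single (i, 1) 1 := by
  ext ⟨j, k⟩
  rw [Matrix.mulVec_single_one]
  by_cases hj : j = i
  · subst hj
    fin_cases k <;> simp [quatI]
  · simp [quatI, hj]

/-- A vector fixed by the stabilizer of `e_i` in `Sp(n)U(1)` has no coordinates outside the span of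
`e_i` and `I e_i`. -/
theorem apply_eq_zero_of_fixed {n : ℕ} {i : Fin n} {v : Fin n × Fin 4 → ℝ}
    (hv : ∀ g, memSpnU1 n g → g.mulVec (Pi.single (i, 0) 1) = Pi.single (i, 0) 1 →
      g.mulVec v = v) {p : Fin n × Fin 4} (h0 : p ≠ (i, 0)) (h1 : p ≠ (i, 1)) : v p = 0 := by
  obtain ⟨j, k⟩ := p
  by_cases hj : j = i
  · subst hj
    have h := congrFun (hv _ (memSpnU1_one_kronecker_diagonal n) (by
      ext p
      rw [← Matrix.diagonal_one, diagonal_kronecker_diagonal_mulVec]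
      by_cases hp : p = (j, 0) <;> simp [hp])) (j, k)
    rw [← Matrix.diagonal_one, diagonal_kronecker_diagonal_mulVec] at h
    fin_cases k <;> simp at h h0 h1 ⊢ <;> linarith
  · have h := congrFun (hv _ (memSpnU1_diagonal_kronecker_one
      (a := fun l => if l = i then 1 else -1) (fun l => by split_ifs <;> norm_num)) (by
      ext p
      rw [← Matrix.diagonal_one, diagonal_kronecker_diagonal_mulVec]
      by_cases hp : p = (i, 0) <;> simp [hp])) (j, k)
    rw [← Matrix.diagonal_one, diagonal_kronecker_diagonal_mulVec] at h
    simp [hj] at h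
    linarith

/-- For `x = e₁ ∈ ℍⁿ` (`n ≥ 2`), the stabilizer `H` of `x` in `Sp(n)U(1)` fixes `Ix`,
has no nonzero fixed vectors orthogonal to `span{x, Ix}`, and the maximal subspace on
which `H` acts trivially is `span{x, Ix}`. -/
theorem stmt_13 (n : ℕ) (hn : 2 ≤ n)
    (x : Fin n × Fin 4 → ℝ) (hx : x = fun p => if p = ((⟨0, by omega⟩ : Fin n), (0 : Fin 4)) then 1 else 0) :
    (∀ g : Matrix (Fin n × Fin 4) (Fin n × Fin 4) ℝ, memSpnU1 n g → g.mulVec x = x →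
        g.mulVec ((quatI n).mulVec x) = (quatI n).mulVec x) ∧
    (∀ v : Fin n × Fin 4 → ℝ,
        (∑ i, v i * x i = 0) → (∑ i, v i * (quatI n).mulVec x i = 0) →
        (∀ g, memSpnU1 n g → g.mulVec x = x → g.mulVec v = v) → v = 0) ∧
    (∀ v : Fin n × Fin 4 → ℝ,
        (∀ g, memSpnU1 n g → g.mulVec x = x → g.mulVec v = v) →
        v ∈ Submodule.span ℝ ({x, (quatI n).mulVec x} : Set (Fin n × Fin 4 → ℝ))) := by
  have hx' : x = Pi.single ((⟨0, by omega⟩ : Fin n), (0 : Fin 4)) 1 := by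
    ext p
    simp [hx, Pi.single_apply]
  clear hx
  generalize (⟨0, by omega⟩ : Fin n) = i at hx'
  subst hx'
  refine ⟨fun g hg hgx => ?_, fun v h0 h1 hv => ?_, fun v hv => ?_⟩
  · rw [Matrix.mulVec_mulVec, hg.2.2.1, ← Matrix.mulVec_mulVec, hgx]
  · rw [quatI_mulVec_single] at h1
    simp [Pi.single_apply] at h0 h1
    ext p
    by_cases hp0 : p = (i, 0)
    · simp [hp0, h0]
    by_cases hp1 : p = (i, 1)
    · simp [hp1, h1]
    exact apply_eq_zero_of_fixed hv hp0 hp1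
  · rw [quatI_mulVec_single, Submodule.mem_span_pair]
    refine ⟨v (i, 0), -v (i, 1), ?_⟩
    ext p
    by_cases hp0 : p = (i, 0)
    · simp [hp0]
    by_cases hp1 : p = (i, 1)
    · simp [hp1]
    simp [hp0, hp1, apply_eq_zero_of_fixed hv hp0 hp1]
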